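/- arXiv:2003.04578 — 7 statements merged into one kernel-verified Lean document; each statement's English description precedes it below -/
import Mathlib

section
/- Let d and k be natural numbers. For every finite family E of finite sets each of cardinality at most d there exists a subfamily E' ⊆ E with |E'| ≤ (k+1)^d and |⋃E'| ≤ d·(k+1)^d such that every finite set S with |S| ≤ k that is a hitting set for E' is also a hitting set for E; in particular, E has a hitting set of cardinality at most k if and only if E' has a hitting set of cardinality at most k. -/
theorem fk_aux {α : Type*} [DecidableEq α] (d k : ℕ) (F : Finset (Finset α))
    (hcard : ∀ e ∈ F, e.card ≤ d)
    (hS : ∀ e ∈ F, ∃ S : Finset α, S.card ≤ k ∧ ¬ (S ∩ e).Nonempty ∧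
      ∀ f ∈ F, f ≠ e → (S ∩ f).Nonempty) :
    ∀ (n : ℕ) (C : Finset α), C.card + n = d →
      (F.filter (fun f => C ⊆ f)).card ≤ (k + 1) ^ n := by
  intro n
  induction n with
  | zero =>
    intro C hC
    rw [pow_zero, Finset.card_le_one]
    intro a ha b hb
    rw [Finset.mem_filter] at ha hb
    have h1 := Finset.eq_of_subset_of_card_le ha.2 (by have := hcard a ha.1; omega)
    have h2 := Finset.eq_of_subset_of_card_le hb.2 (by have := hcard b hb.1; omega)
    exact h1.symm.trans h2
  | succ n ih =>
    intro C hC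
    rcases (F.filter (fun f => C ⊆ f)).eq_empty_or_nonempty with h0 | ⟨e, he⟩
    · rw [h0]; simp
    rw [Finset.mem_filter] at he
    obtain ⟨S, hSk, hSe, hSf⟩ := hS e he.1
    have hsub : F.filter (fun f => C ⊆ f) ⊆
        insert e (S.biUnion fun x => F.filter (fun f => insert x C ⊆ f)) := by
      intro f hf
      rw [Finset.mem_filter] at hf
      by_cases hfe : f = e
      · simp [hfe]
      obtain ⟨x, hx⟩ := hSf f hf.1 hfe
      rw [Finset.mem_inter] at hx
      refine Finset.mem_insert_of_mem (Finset.mem_biUnion.2 ⟨x, hx.1, ?_⟩)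
      exact Finset.mem_filter.2 ⟨hf.1, Finset.insert_subset hx.2 hf.2⟩
    have hb : (S.biUnion fun x => F.filter (fun f => insert x C ⊆ f)).card
        ≤ S.card * (k + 1) ^ n := by
      apply Finset.card_biUnion_le_card_mul
      intro x hx
      apply ih
      have hxC : x ∉ C := fun h => hSe ⟨x, Finset.mem_inter.2 ⟨hx, he.2 h⟩⟩
      rw [Finset.card_insert_of_notMem hxC]
      omega
    have h1 := Finset.card_le_card hsub
    have h2 := Finset.card_insert_le e
      (S.biUnion fun x => F.filter (fun f => insert x C ⊆ f))
    have h3 : S.card * (k + 1) ^ n ≤ k * (k + 1) ^ n := Nat.mul_le_mul_right _ hSk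
    have h4 : 1 ≤ (k + 1) ^ n := Nat.one_le_pow _ _ (by omega)
    have h5 : (k + 1) ^ (n + 1) = k * (k + 1) ^ n + (k + 1) ^ n := by ring
    omega

/-- Optimal-size problem kernel for d-Hitting Set (algorithm FK).
Every finite family `E` of finite sets of cardinality at most `d` has a subfamily
`E'` with at most `(k+1)^d` edges and at most `d·(k+1)^d` vertices such that every
size-`≤ k` hitting set for `E'` is a hitting set for `E`; in particular, `E` has a
hitting set of size at most `k` iff `E'` has one. -/
theorem fk_kernel {α : Type*} [DecidableEq α] (d k : ℕ)
    (E : Finset (Finset α)) (hcard : ∀ e ∈ E, e.card ≤ d) :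
    ∃ E' ⊆ E, E'.card ≤ (k + 1) ^ d ∧
      (E'.biUnion id).card ≤ d * (k + 1) ^ d ∧
      (∀ S : Finset α, S.card ≤ k → (∀ e ∈ E', (S ∩ e).Nonempty) →
        (∀ e ∈ E, (S ∩ e).Nonempty)) ∧
      ((∃ S : Finset α, S.card ≤ k ∧ ∀ e ∈ E, (S ∩ e).Nonempty) ↔
        (∃ S : Finset α, S.card ≤ k ∧ ∀ e ∈ E', (S ∩ e).Nonempty)) := by
  classical
  obtain ⟨E', hE', hmin⟩ := Finset.exists_min_image
    (E.powerset.filter fun E' => ∀ S : Finset α, S.card ≤ k →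
      (∀ e ∈ E', (S ∩ e).Nonempty) → (∀ e ∈ E, (S ∩ e).Nonempty)) Finset.card
    ⟨E, by simp⟩
  rw [Finset.mem_filter, Finset.mem_powerset] at hE'
  obtain ⟨hsub, hgood⟩ := hE'
  have hc : E'.card ≤ (k + 1) ^ d := by
    have := fk_aux d k E' (fun e he => hcard e (hsub he)) (by
      intro e he
      by_contra hcon
      have hlt := Finset.card_erase_lt_of_mem he
      refine absurd (hmin (E'.erase e) ?_) (not_le.2 hlt)
      rw [Finset.mem_filter, Finset.mem_powerset]
      refine ⟨(Finset.erase_subset _ _).trans hsub, fun S hSk hS => hgood S hSk ?_⟩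
      intro f hf
      by_cases hfe : f = e
      · subst hfe
        by_contra hne
        exact hcon ⟨S, hSk, hne, fun g hg hgf => hS g (Finset.mem_erase.2 ⟨hgf, hg⟩)⟩
      · exact hS f (Finset.mem_erase.2 ⟨hfe, hf⟩)) d ∅ (by simp)
    simpa using this
  refine ⟨E', hsub, hc, ?_, hgood, ?_, ?_⟩
  · calc (E'.biUnion id).card ≤ E'.card * d :=
          Finset.card_biUnion_le_card_mul _ _ _ fun e he => hcard e (hsub he)
      _ ≤ (k + 1) ^ d * d := Nat.mul_le_mul_right _ hc
      _ = d * (k + 1) ^ d := mul_comm _ _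
  · rintro ⟨S, h, h'⟩
    exact ⟨S, h, fun e he => h' e (hsub he)⟩
  · rintro ⟨S, h, h'⟩
    exact ⟨S, h, hgood S h h'⟩
end

section
/- Let k be a natural number and let E_out ⊆ E_in be finite families of finite sets. Suppose that for every edge e ∈ E_in \ E_out there exists a subset s ⊆ e and k+1 pairwise distinct members of E_out whose pairwise intersections all equal s (a sunflower with k+1 petals and core s contained in E_out). Then every finite set S with |S| ≤ k that is a hitting set for E_out is also a hitting set for E_in; in particular, E_in has a hitting set of cardinality at most k if and only if E_out has a hitting set of cardinality at most k. -/
/-- Correctness of the sunflower-based kernelization Bev. If every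
discarded edge `e ∈ E_in \ E_out` contains the core `s` of a sunflower with `k+1`
petals in `E_out`, then every size-`≤ k` hitting set for `E_out` is a hitting set
for `E_in`; in particular, `E_in` has a hitting set of size at most `k` iff
`E_out` has one. -/
theorem bev_correct {α : Type*} [DecidableEq α] (k : ℕ)
    (Ein Eout : Finset (Finset α)) (hsub : Eout ⊆ Ein)
    (hdisc : ∀ e ∈ Ein \ Eout, ∃ s ⊆ e, ∃ P ⊆ Eout, P.card = k + 1 ∧
      ∀ p ∈ P, ∀ p' ∈ P, p ≠ p' → p ∩ p' = s) :
    (∀ S : Finset α, S.card ≤ k → (∀ e ∈ Eout, (S ∩ e).Nonempty) →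
      (∀ e ∈ Ein, (S ∩ e).Nonempty)) ∧
    ((∃ S : Finset α, S.card ≤ k ∧ ∀ e ∈ Ein, (S ∩ e).Nonempty) ↔
      (∃ S : Finset α, S.card ≤ k ∧ ∀ e ∈ Eout, (S ∩ e).Nonempty)) := by
  have key : ∀ S : Finset α, S.card ≤ k → (∀ e ∈ Eout, (S ∩ e).Nonempty) →
      (∀ e ∈ Ein, (S ∩ e).Nonempty) := by
    intro S hS hit e he
    by_cases heo : e ∈ Eout
    · exact hit e heo
    obtain ⟨s, hse, P, hP, hcard, hsun⟩ := hdisc e (Finset.mem_sdiff.2 ⟨he, heo⟩)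
    have hex : ∀ p : P, ∃ x, x ∈ S ∩ p.1 := fun p => hit p.1 (hP p.2)
    choose f hf using hex
    have hlt : S.card < P.attach.card := by
      rw [Finset.card_attach]
      omega
    obtain ⟨p, -, q, -, hpq, hfe⟩ := Finset.exists_ne_map_eq_of_card_lt_of_maps_to hlt
      (f := f) (fun p _ => (Finset.mem_inter.1 (hf p)).1)
    have hp := Finset.mem_inter.1 (hf p)
    have hq := Finset.mem_inter.1 (hf q)
    rw [← hfe] at hq
    have hs := hsun p.1 p.2 q.1 q.2 (fun h => hpq (Subtype.ext h))
    refine ⟨f p, Finset.mem_inter.2 ⟨hp.1, hse ?_⟩⟩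
    rw [← hs]
    exact Finset.mem_inter.2 ⟨hp.2, hq.2⟩
  refine ⟨key, ?_, ?_⟩
  · rintro ⟨S, hS, h⟩
    exact ⟨S, hS, fun e he => h e (hsub he)⟩
  · rintro ⟨S, hS, h⟩
    exact ⟨S, hS, key S hS h⟩
end

section
/- Let d and k be natural numbers, let s be a finite set, and let F be a finite family of finite sets, each containing s and each of cardinality at most d. Let P ⊆ F be maximal with respect to inclusion among subfamilies of F whose members have pairwise disjoint differences with s (i.e., for distinct p, p' ∈ P, the sets p \ s and p' \ s are disjoint). If F contains at least k·(d+1)+1 pairwise distinct members whose pairwise intersections all equal s (a sunflower with core s and at least k·(d+1)+1 petals), then |P| ≥ k+1. -/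
/-- Greedy petal collections certify large sunflowers. Let `F` be a finite
family of finite sets, each containing `s` and of cardinality at most `d`. Let `P ⊆ F`
be maximal (w.r.t. inclusion) among subfamilies of `F` whose members have pairwise
disjoint differences with `s`. If `F` contains a sunflower with core `s` and at least
`k·(d+1)+1` petals, then `|P| ≥ k+1`. -/
theorem greedy_petals_large {α : Type*} [DecidableEq α] (d k : ℕ)
    (s : Finset α) (F : Finset (Finset α))
    (hFs : ∀ e ∈ F, s ⊆ e) (hFd : ∀ e ∈ F, e.card ≤ d)
    (P : Finset (Finset α)) (hPF : P ⊆ F)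
    (hPdisj : ∀ p ∈ P, ∀ p' ∈ P, p ≠ p' → Disjoint (p \ s) (p' \ s))
    (hPmax : ∀ Q : Finset (Finset α), Q ⊆ F → P ⊆ Q →
      (∀ p ∈ Q, ∀ p' ∈ Q, p ≠ p' → Disjoint (p \ s) (p' \ s)) → Q = P)
    (G : Finset (Finset α)) (hGF : G ⊆ F)
    (hGcard : k * (d + 1) + 1 ≤ G.card)
    (hGsun : ∀ p ∈ G, ∀ p' ∈ G, p ≠ p' → p ∩ p' = s) :
    k + 1 ≤ P.card := by
  have hcov : G ⊆ P.biUnion (fun p => insert p (G.filter (fun g => ¬ Disjoint (g \ s) (p \ s)))) := by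
    intro g hg
    by_contra hcon
    simp only [Finset.mem_biUnion, Finset.mem_insert, Finset.mem_filter, not_exists, not_and,
      not_or, not_not] at hcon
    have hd : ∀ p ∈ P, Disjoint (g \ s) (p \ s) := fun p hp => (hcon p hp).2 hg
    have hQ := hPmax (insert g P) (Finset.insert_subset (hGF hg) hPF)
      (Finset.subset_insert g P) (by
        intro p hp p' hp' hne
        rcases Finset.mem_insert.1 hp with rfl | hpP
        · rcases Finset.mem_insert.1 hp' with rfl | hp'
          · exact absurd rfl hne
          · exact hd p' hp'
        · rcases Finset.mem_insert.1 hp' with rfl | hp'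
          · exact (hd p hpP).symm
          · exact hPdisj p hpP p' hp' hne)
    have hgP : g ∈ P := hQ ▸ Finset.mem_insert_self g P
    exact (hcon g hgP).1 rfl
  have hb : ∀ p ∈ P, (insert p (G.filter (fun g => ¬ Disjoint (g \ s) (p \ s)))).card ≤ d + 1 := by
    intro p hp
    refine (Finset.card_insert_le _ _).trans (Nat.succ_le_succ ?_)
    refine le_trans ?_ (hFd p (hPF hp))
    have hx : ∀ g ∈ G.filter (fun g => ¬ Disjoint (g \ s) (p \ s)),
        ∃ x, x ∈ g ∧ x ∉ s ∧ x ∈ p := by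
      intro g hg
      obtain ⟨x, h1, h2⟩ := Finset.not_disjoint_iff.1 (Finset.mem_filter.1 hg).2
      rw [Finset.mem_sdiff] at h1 h2
      exact ⟨x, h1.1, h1.2, h2.1⟩
    rcases Finset.eq_empty_or_nonempty (G.filter (fun g => ¬ Disjoint (g \ s) (p \ s))) with he | ⟨g0, hg0⟩
    · rw [he]; simp
    haveI : Nonempty α := ⟨(hx g0 hg0).choose⟩
    choose! f hf using hx
    refine Finset.card_le_card_of_injOn f (fun g hg => (hf g hg).2.2) ?_
    intro a ha b hb hab
    by_contra hne
    have h := hGsun a (Finset.mem_filter.1 ha).1 b (Finset.mem_filter.1 hb).1 hne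
    apply (hf a ha).2.1
    rw [← h]
    exact Finset.mem_inter.2 ⟨(hf a ha).1, hab ▸ (hf b hb).1⟩
  have h1 := (Finset.card_le_card hcov).trans (Finset.card_biUnion_le_card_mul _ _ _ hb)
  by_contra hlt
  have h2 : P.card ≤ k := by omega
  have h3 := Nat.mul_le_mul_right (d + 1) h2
  omega
end

section
/- Let d ≥ 1 and k be natural numbers and let F be a finite family of pairwise distinct finite sets, each of cardinality exactly d. If |F| > d! · k^d, then F contains k+1 pairwise distinct members whose pairwise intersections all equal some common set s, i.e., F contains a sunflower with k+1 petals. -/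
theorem sunflower_aux {α : Type*} [DecidableEq α] (k : ℕ) (d : ℕ) :
    ∀ F : Finset (Finset α), (∀ e ∈ F, e.card = d) →
    Nat.factorial d * k ^ d < F.card →
    ∃ s : Finset α, ∃ P ⊆ F, P.card = k + 1 ∧
      ∀ p ∈ P, ∀ p' ∈ P, p ≠ p' → p ∩ p' = s := by
  induction d with
  | zero =>
    intro F hF hb
    exfalso
    have : F ⊆ {∅} := fun e he => by
      simpa using hF e he
    have := Finset.card_le_card this
    simp at hb this
    omega
  | succ d ih =>
    intro F hF hb
    let S := F.powerset.filter (fun P => ∀ p ∈ P, ∀ p' ∈ P, p ≠ p' → p ∩ p' = ∅)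
    have hS : S.Nonempty := ⟨∅, by simp [S]⟩
    obtain ⟨P, hPS, hmax⟩ := Finset.exists_max_image S Finset.card hS
    obtain ⟨hPF, hPd⟩ : P ⊆ F ∧ ∀ p ∈ P, ∀ p' ∈ P, p ≠ p' → p ∩ p' = ∅ := by
      simpa only [S, Finset.mem_filter, Finset.mem_powerset] using hPS
    by_cases hk : k + 1 ≤ P.card
    · obtain ⟨Q, hQP, hQ⟩ := Finset.exists_subset_card_eq hk
      exact ⟨∅, Q, hQP.trans hPF, hQ, fun p hp p' hp' => hPd p (hQP hp) p' (hQP hp')⟩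
    have hU : (P.biUnion id).card ≤ P.card * (d + 1) :=
      Finset.card_biUnion_le_card_mul _ _ _ (fun p hp => (hF p (hPF hp)).le)
    have hmeet : ∀ e ∈ F, ∃ x ∈ P.biUnion id, x ∈ e := by
      intro e he
      by_contra! hno
      have hdis : ∀ p ∈ P, p ∩ e = ∅ := by
        intro p hp
        ext y
        simp only [Finset.mem_inter, Finset.notMem_empty, iff_false, not_and]
        intro hy
        exact hno y (Finset.mem_biUnion.2 ⟨p, hp, hy⟩)
      have heP : e ∉ P := by
        intro h
        have h1 := hdis e h
        rw [Finset.inter_self] at h1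
        have := hF e he
        simp [h1] at this
      have hin : insert e P ∈ S := by
        simp only [S, Finset.mem_filter, Finset.mem_powerset]
        refine ⟨Finset.insert_subset he hPF, ?_⟩
        intro p hp p' hp' hne
        rcases Finset.mem_insert.1 hp with rfl | hpP
        · rcases Finset.mem_insert.1 hp' with rfl | hp'
          · exact absurd rfl hne
          · rw [Finset.inter_comm]; exact hdis p' hp'
        · rcases Finset.mem_insert.1 hp' with rfl | hp'
          · exact hdis p hpP
          · exact hPd p hpP p' hp' hne
      have := hmax _ hin
      rw [Finset.card_insert_of_notMem heP] at this
      omega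
    obtain ⟨x, -, hx⟩ : ∃ x ∈ P.biUnion id,
        Nat.factorial d * k ^ d < (F.filter (fun e => x ∈ e)).card := by
      by_contra! hno
      have h1 : F ⊆ (P.biUnion id).biUnion (fun x => F.filter (fun e => x ∈ e)) := by
        intro e he
        obtain ⟨x, hx, hxe⟩ := hmeet e he
        exact Finset.mem_biUnion.2 ⟨x, hx, Finset.mem_filter.2 ⟨he, hxe⟩⟩
      have h2 := (Finset.card_le_card h1).trans (Finset.card_biUnion_le_card_mul _ _ _ hno)
      have h3 : (P.biUnion id).card ≤ k * (d + 1) :=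
        hU.trans (Nat.mul_le_mul_right _ (by omega))
      have h4 := h2.trans (Nat.mul_le_mul_right _ h3)
      have h5 : k * (d + 1) * (Nat.factorial d * k ^ d)
          = Nat.factorial (d + 1) * k ^ (d + 1) := by
        rw [Nat.factorial_succ, pow_succ]; ring
      omega
    have hinj : Set.InjOn (fun e : Finset α => e.erase x)
        (F.filter (fun e => x ∈ e) : Finset (Finset α)) := by
      intro a ha b hb hab
      have ha' := (Finset.mem_filter.1 (Finset.mem_coe.1 ha)).2
      have hb' := (Finset.mem_filter.1 (Finset.mem_coe.1 hb)).2
      have hab : a.erase x = b.erase x := hab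
      rw [← Finset.insert_erase ha', ← Finset.insert_erase hb', hab]
    obtain ⟨s, Q, hQ, hQc, hQs⟩ := ih ((F.filter (fun e => x ∈ e)).image (fun e => e.erase x))
      (by
        intro e he
        obtain ⟨a, ha, rfl⟩ := Finset.mem_image.1 he
        obtain ⟨haF, hxa⟩ := Finset.mem_filter.1 ha
        simp [Finset.card_erase_of_mem hxa, hF a haF])
      (by rwa [Finset.card_image_of_injOn hinj])
    have hQ' : ∀ q ∈ Q, x ∉ q ∧ insert x q ∈ F := by
      intro q hq
      obtain ⟨a, ha, rfl⟩ := Finset.mem_image.1 (hQ hq)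
      obtain ⟨haF, hxa⟩ := Finset.mem_filter.1 ha
      exact ⟨Finset.notMem_erase _ _, by rwa [Finset.insert_erase hxa]⟩
    refine ⟨insert x s, Q.image (fun q => insert x q), ?_, ?_, ?_⟩
    · intro e he
      obtain ⟨q, hq, rfl⟩ := Finset.mem_image.1 he
      exact (hQ' q hq).2
    · rw [Finset.card_image_of_injOn, hQc]
      intro a ha b hb hab
      have hab : insert x a = insert x b := hab
      rw [← Finset.erase_insert (hQ' a ha).1, ← Finset.erase_insert (hQ' b hb).1, hab]
    · intro p hp p' hp' hne
      obtain ⟨q, hq, rfl⟩ := Finset.mem_image.1 hp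
      obtain ⟨q', hq', rfl⟩ := Finset.mem_image.1 hp'
      have : q ≠ q' := fun h => hne (by rw [h])
      rw [← Finset.insert_inter_distrib, hQs q hq q' hq' this]


/-- Erdős–Rado sunflower lemma: If `F` is a finite family of pairwise
distinct finite sets of cardinality exactly `d ≥ 1` with `|F| > d! · k^d`, then `F`
contains a sunflower with `k+1` petals, i.e., `k+1` pairwise distinct members whose
pairwise intersections all equal some common set `s`. -/
theorem erdos_rado_sunflower {α : Type*} [DecidableEq α] (d k : ℕ) (hd : 1 ≤ d)
    (F : Finset (Finset α)) (hFd : ∀ e ∈ F, e.card = d)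
    (hFbig : Nat.factorial d * k ^ d < F.card) :
    ∃ s : Finset α, ∃ P ⊆ F, P.card = k + 1 ∧
      ∀ p ∈ P, ∀ p' ∈ P, p ≠ p' → p ∩ p' = s := by
  exact sunflower_aux k d F hFd hFbig
end

section
/- Let d ≥ 1 and k be natural numbers and let F be a finite family of pairwise distinct nonempty finite sets, each of cardinality at most d. If F contains no sunflower with d·(k+1)+1 petals (i.e., no d·(k+1)+1 pairwise distinct members of F have pairwise equal intersections), then |F| ≤ d! · d^(d+1) · (k+1)^d. -/
theorem uniform_sunflower_aux {α : Type*} [DecidableEq α] (m l : ℕ) :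
    ∀ (F : Finset (Finset α)), (∀ e ∈ F, e.card = l) →
    (¬ ∃ s : Finset α, ∃ P ⊆ F, P.card = m + 1 ∧
      ∀ p ∈ P, ∀ p' ∈ P, p ≠ p' → p ∩ p' = s) →
    F.card ≤ Nat.factorial l * m ^ l := by
  induction l with
  | zero =>
    intro F hF _
    have h : F ⊆ {∅} := by
      intro e he
      simpa using hF e he
    simpa using Finset.card_le_card h
  | succ l ih =>
    intro F hF hno
    obtain ⟨M, hM, hmax⟩ := Finset.exists_max_image
      (F.powerset.filter (fun M => ∀ p ∈ M, ∀ p' ∈ M, p ≠ p' → p ∩ p' = ∅)) Finset.card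
      ⟨∅, by simp⟩
    simp only [Finset.mem_filter, Finset.mem_powerset] at hM hmax
    obtain ⟨hMF, hMd⟩ := hM
    have hMm : M.card ≤ m := by
      by_contra hc
      obtain ⟨P, hP, hPc⟩ := Finset.exists_subset_card_eq (show m + 1 ≤ M.card by omega)
      exact hno ⟨∅, P, hP.trans hMF, hPc, fun p hp p' hp' => hMd p (hP hp) p' (hP hp')⟩
    have hU : (M.biUnion id).card ≤ m * (l + 1) := by
      refine (Finset.card_biUnion_le_card_mul M id (l + 1) ?_).trans
        (Nat.mul_le_mul_right _ hMm)
      intro e he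
      exact (hF e (hMF he)).le
    have hcov : F ⊆ (M.biUnion id).biUnion (fun x => F.filter (fun e => x ∈ e)) := by
      intro e he
      by_contra hc
      simp only [Finset.mem_biUnion, Finset.mem_filter, id, not_exists, not_and] at hc
      have hdis : ∀ p ∈ M, e ∩ p = ∅ := by
        intro p hp
        ext x
        simp only [Finset.mem_inter, Finset.notMem_empty, iff_false, not_and]
        intro hxe hxp
        exact hc x ⟨p, hp, hxp⟩ he hxe
      have heM : e ∉ M := by
        intro h
        have h1 := hdis e h
        have h2 := hF e he
        rw [Finset.inter_self] at h1
        simp [h1] at h2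
      have := hmax (insert e M) ⟨Finset.insert_subset he hMF, by
        intro p hp p' hp' hne
        rcases Finset.mem_insert.1 hp with rfl | hpM
        · rcases Finset.mem_insert.1 hp' with rfl | hp'
          · exact absurd rfl hne
          · exact hdis p' hp'
        · rcases Finset.mem_insert.1 hp' with rfl | hp'
          · rw [Finset.inter_comm]; exact hdis p hpM
          · exact hMd p hpM p' hp' hne⟩
      rw [Finset.card_insert_of_notMem heM] at this
      omega
    have hstep : ∀ x ∈ M.biUnion id,
        (F.filter (fun e => x ∈ e)).card ≤ Nat.factorial l * m ^ l := by
      intro x _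
      have hinj : Set.InjOn (fun e : Finset α => e.erase x) (F.filter (fun e => x ∈ e)) := by
        intro a ha b hb hab
        simp only [Finset.coe_filter, Set.mem_ofPred_eq] at ha hb
        have : insert x (a.erase x) = insert x (b.erase x) := congrArg (insert x) hab
        rwa [Finset.insert_erase ha.2, Finset.insert_erase hb.2] at this
      rw [← Finset.card_image_of_injOn hinj]
      have hmem : ∀ p ∈ (F.filter (fun e => x ∈ e)).image (fun e => e.erase x),
          x ∉ p ∧ insert x p ∈ F := by
        intro p hp
        obtain ⟨e, he, rfl⟩ := Finset.mem_image.1 hp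
        rw [Finset.mem_filter] at he
        refine ⟨Finset.notMem_erase x e, ?_⟩
        simp only [Finset.insert_erase he.2]
        exact he.1
      apply ih
      · intro p hp
        obtain ⟨h1, h2⟩ := hmem p hp
        have := hF _ h2
        rw [Finset.card_insert_of_notMem h1] at this
        omega
      · rintro ⟨s, P, hP, hPc, hs⟩
        refine hno ⟨insert x s, P.image (insert x), ?_, ?_, ?_⟩
        · intro q hq
          obtain ⟨p, hp, rfl⟩ := Finset.mem_image.1 hq
          exact (hmem p (hP hp)).2
        · rw [Finset.card_image_of_injOn, hPc]
          intro a ha b hb hab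
          have h := congrArg (fun e : Finset α => e.erase x) hab
          simp only [Finset.erase_insert (hmem a (hP ha)).1,
            Finset.erase_insert (hmem b (hP hb)).1] at h
          exact h
        · intro q hq q' hq' hne
          obtain ⟨p, hp, rfl⟩ := Finset.mem_image.1 hq
          obtain ⟨p', hp', rfl⟩ := Finset.mem_image.1 hq'
          rw [← Finset.insert_inter_distrib, hs p hp p' hp' (fun h => hne (by rw [h]))]
    calc F.card ≤ _ := Finset.card_le_card hcov
      _ ≤ (M.biUnion id).card * (Nat.factorial l * m ^ l) :=
        Finset.card_biUnion_le_card_mul _ _ _ hstep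
      _ ≤ m * (l + 1) * (Nat.factorial l * m ^ l) := Nat.mul_le_mul_right _ hU
      _ = _ := by rw [Nat.factorial_succ]; ring

/-- If `F` is a finite family of pairwise distinct nonempty finite sets,
each of cardinality at most `d ≥ 1`, and `F` contains no sunflower with `d·(k+1)+1`
petals, then `|F| ≤ d! · d^(d+1) · (k+1)^d`. -/
theorem no_sunflower_card_bound {α : Type*} [DecidableEq α] (d k : ℕ) (hd : 1 ≤ d)
    (F : Finset (Finset α)) (hne : ∀ e ∈ F, e.Nonempty) (hFd : ∀ e ∈ F, e.card ≤ d)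
    (hnosun : ¬ ∃ s : Finset α, ∃ P ⊆ F, P.card = d * (k + 1) + 1 ∧
      ∀ p ∈ P, ∀ p' ∈ P, p ≠ p' → p ∩ p' = s) :
    F.card ≤ Nat.factorial d * d ^ (d + 1) * (k + 1) ^ d := by
  have hcov : F ⊆ (Finset.Icc 1 d).biUnion (fun l => F.filter (fun e => e.card = l)) := by
    intro e he
    simp only [Finset.mem_biUnion, Finset.mem_filter, Finset.mem_Icc]
    exact ⟨e.card, ⟨(hne e he).card_pos, hFd e he⟩, he, rfl⟩
  have hstep : ∀ l ∈ Finset.Icc 1 d, (F.filter (fun e => e.card = l)).card ≤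
      Nat.factorial d * (d * (k + 1)) ^ d := by
    intro l hl
    rw [Finset.mem_Icc] at hl
    refine (uniform_sunflower_aux (d * (k + 1)) l _
      (fun e he => (Finset.mem_filter.1 he).2) ?_).trans ?_
    · rintro ⟨s, P, hP, h⟩
      exact hnosun ⟨s, P, hP.trans (Finset.filter_subset _ _), h⟩
    · exact Nat.mul_le_mul (Nat.factorial_le hl.2)
        (Nat.pow_le_pow_right (Nat.mul_pos hd (Nat.succ_pos k)) hl.2)
  calc F.card ≤ _ := Finset.card_le_card hcov
    _ ≤ (Finset.Icc 1 d).card * (Nat.factorial d * (d * (k + 1)) ^ d) :=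
      Finset.card_biUnion_le_card_mul _ _ _ hstep
    _ = _ := by rw [Nat.card_Icc, Nat.add_sub_cancel, mul_pow]; ring
end

section
/- Let k be a natural number, let E be a finite family of finite sets, and let u and v be distinct vertices such that every edge e ∈ E with v ∈ e also satisfies u ∈ e. Then E has a hitting set of cardinality at most k if and only if the family {e \ {v} : e ∈ E} has a hitting set of cardinality at most k. -/
/-- Correctness of Weihe's first data reduction rule. If `u ≠ v` and every
edge of `E` containing `v` also contains `u`, then `E` has a hitting set of size at most
`k` iff the family obtained by deleting `v` from every edge has one. -/
theorem weihe_vertex_rule {α : Type*} [DecidableEq α] (k : ℕ)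
    (E : Finset (Finset α)) (u v : α) (huv : u ≠ v)
    (hdom : ∀ e ∈ E, v ∈ e → u ∈ e) :
    (∃ S : Finset α, S.card ≤ k ∧ ∀ e ∈ E, (S ∩ e).Nonempty) ↔
    (∃ S : Finset α, S.card ≤ k ∧ ∀ e ∈ E.image (fun f => f.erase v), (S ∩ e).Nonempty) := by
  constructor
  · rintro ⟨S, hS, h⟩
    refine ⟨S.image (fun x => if x = v then u else x), Finset.card_image_le.trans hS, ?_⟩
    intro e' he'
    obtain ⟨e, he, rfl⟩ := Finset.mem_image.1 he'
    obtain ⟨x, hx⟩ := h e he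
    obtain ⟨hxS, hxe⟩ := Finset.mem_inter.1 hx
    refine ⟨if x = v then u else x, Finset.mem_inter.2 ⟨Finset.mem_image_of_mem _ hxS, ?_⟩⟩
    by_cases hxv : x = v
    · rw [if_pos hxv]
      exact Finset.mem_erase.2 ⟨huv, hdom e he (hxv ▸ hxe)⟩
    · rw [if_neg hxv]
      exact Finset.mem_erase.2 ⟨hxv, hxe⟩
  · rintro ⟨S, hS, h⟩
    refine ⟨S, hS, fun e he => ?_⟩
    exact (h _ (Finset.mem_image_of_mem _ he)).mono
      (Finset.inter_subset_inter_left (Finset.erase_subset v e))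
end

section
/- Let d ≥ 1 and k be natural numbers. For every finite family E of pairwise distinct nonempty finite sets each of cardinality at most d there exists a subfamily E' ⊆ E with |E'| ≤ d! · d^(d+1) · (k+1)^d such that every finite set S with |S| ≤ k that is a hitting set for E' is also a hitting set for E; in particular, E has a hitting set of cardinality at most k if and only if E' has a hitting set of cardinality at most k. -/
theorem cross_bound {α ι : Type*} [DecidableEq α] [DecidableEq ι] (k : ℕ) (B : ι → Finset α) :
    ∀ (d : ℕ) (F : Finset ι) (A : ι → Finset α),
      (∀ i ∈ F, (A i).card ≤ d) → (∀ i ∈ F, (B i).card ≤ k) →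
      (∀ i ∈ F, Disjoint (B i) (A i)) →
      (∀ i ∈ F, ∀ j ∈ F, i ≠ j → (B i ∩ A j).Nonempty) → F.card ≤ (k + 1) ^ d := by
  intro d
  induction d with
  | zero =>
    intro F A hA hB hd hc
    rw [pow_zero, Finset.card_le_one]
    intro i hi j hj
    by_contra hij
    obtain ⟨x, hx⟩ := hc i hi j hj hij
    have h0 : A j = ∅ := Finset.card_eq_zero.mp (Nat.le_zero.mp (hA j hj))
    simp [h0] at hx
  | succ d ih =>
    intro F A hA hB hd hc
    rcases F.eq_empty_or_nonempty with rfl | ⟨i, hi⟩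
    · simp
    have hsub : F ⊆ insert i ((B i).biUnion fun x => F.filter fun j => x ∈ A j) := by
      intro j hj
      by_cases hij : i = j
      · simp [hij]
      · obtain ⟨x, hx⟩ := hc i hi j hj hij
        rw [Finset.mem_inter] at hx
        refine Finset.mem_insert_of_mem (Finset.mem_biUnion.mpr ⟨x, hx.1, ?_⟩)
        exact Finset.mem_filter.mpr ⟨hj, hx.2⟩
    have hx : ∀ x ∈ B i, (F.filter fun j => x ∈ A j).card ≤ (k + 1) ^ d := by
      intro x _
      apply ih _ (fun j => (A j).erase x)
      · intro j hj
        rw [Finset.mem_filter] at hj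
        have := hA j hj.1
        rw [Finset.card_erase_of_mem hj.2]
        omega
      · intro j hj
        exact hB j (Finset.mem_filter.mp hj).1
      · intro j hj
        exact (hd j (Finset.mem_filter.mp hj).1).mono_right (Finset.erase_subset _ _)
      · intro a ha b hb hab
        rw [Finset.mem_filter] at ha hb
        obtain ⟨y, hy⟩ := hc a ha.1 b hb.1 hab
        rw [Finset.mem_inter] at hy
        refine ⟨y, Finset.mem_inter.mpr ⟨hy.1, Finset.mem_erase.mpr ⟨?_, hy.2⟩⟩⟩
        rintro rfl
        exact Finset.disjoint_left.mp (hd a ha.1) hy.1 ha.2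
    have h1 := Finset.card_le_card hsub
    have h2 := Finset.card_insert_le i ((B i).biUnion fun x => F.filter fun j => x ∈ A j)
    have h3 := Finset.card_biUnion_le_card_mul _ _ _ hx
    have h4 : (B i).card * (k + 1) ^ d ≤ k * (k + 1) ^ d := Nat.mul_le_mul_right _ (hB i hi)
    have h5 : 1 ≤ (k + 1) ^ d := Nat.one_le_pow _ _ (Nat.succ_pos k)
    have h6 : (k + 1) ^ (d + 1) = k * (k + 1) ^ d + (k + 1) ^ d := by ring
    omega

theorem kernel_aux {α : Type*} [DecidableEq α] (d k : ℕ) (E : Finset (Finset α))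
    (hcard : ∀ e ∈ E, e.card ≤ d) :
    ∃ E' ⊆ E, E'.card ≤ (k + 1) ^ d ∧
      (∀ S : Finset α, S.card ≤ k → (∀ e ∈ E', (S ∩ e).Nonempty) →
        (∀ e ∈ E, (S ∩ e).Nonempty)) := by
  induction E using Finset.strongInduction with
  | H E ih =>
    by_cases h : ∃ e ∈ E, ∀ S : Finset α, S.card ≤ k →
        (∀ f ∈ E.erase e, (S ∩ f).Nonempty) → (S ∩ e).Nonempty
    · obtain ⟨e, he, h⟩ := h
      obtain ⟨E', hs, hc, hh⟩ := ih (E.erase e) (Finset.erase_ssubset he)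
        (fun f hf => hcard f (Finset.mem_of_mem_erase hf))
      refine ⟨E', hs.trans (Finset.erase_subset _ _), hc, ?_⟩
      intro S hS hS' f hf
      by_cases hfe : f = e
      · subst hfe
        exact h S hS (hh S hS hS')
      · exact hh S hS hS' f (Finset.mem_erase.mpr ⟨hfe, hf⟩)
    · push Not at h
      choose! B hB1 hB2 hB3 using h
      refine ⟨E, subset_rfl, ?_, fun S _ h => h⟩
      apply cross_bound k B d E id hcard hB1
      · intro e he
        exact Finset.disjoint_iff_inter_eq_empty.mpr (hB3 e he)
      · intro e he f hf hef
        exact hB2 e he f (Finset.mem_erase.mpr ⟨hef.symm, hf⟩)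

/-- Size and correctness guarantee of the sunflower-based kernel Bev.
Every finite family `E` of pairwise distinct nonempty finite sets of cardinality at
most `d ≥ 1` has a subfamily `E'` with `|E'| ≤ d! · d^(d+1) · (k+1)^d` such that
every size-`≤ k` hitting set for `E'` is a hitting set for `E`; in particular, `E`
has a hitting set of size at most `k` iff `E'` has one. -/
theorem bev_kernel {α : Type*} [DecidableEq α] (d k : ℕ) (hd : 1 ≤ d)
    (E : Finset (Finset α)) (hne : ∀ e ∈ E, e.Nonempty) (hcard : ∀ e ∈ E, e.card ≤ d) :
    ∃ E' ⊆ E, E'.card ≤ Nat.factorial d * d ^ (d + 1) * (k + 1) ^ d ∧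
      (∀ S : Finset α, S.card ≤ k → (∀ e ∈ E', (S ∩ e).Nonempty) →
        (∀ e ∈ E, (S ∩ e).Nonempty)) ∧
      ((∃ S : Finset α, S.card ≤ k ∧ ∀ e ∈ E, (S ∩ e).Nonempty) ↔
        (∃ S : Finset α, S.card ≤ k ∧ ∀ e ∈ E', (S ∩ e).Nonempty)) := by
  obtain ⟨E', hs, hc, hh⟩ := kernel_aux d k E hcard
  refine ⟨E', hs, hc.trans ?_, hh, ?_, ?_⟩
  · apply Nat.le_mul_of_pos_left
    have := Nat.factorial_pos d
    positivity
  · rintro ⟨S, h1, h2⟩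
    exact ⟨S, h1, fun e he => h2 e (hs he)⟩
  · rintro ⟨S, h1, h2⟩
    exact ⟨S, h1, hh S h1 h2⟩
end
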